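/- arXiv:2510.16930 — 5 statements merged into one kernel-verified Lean document; each statement's English description precedes it below -/
import Mathlib

section
/- Let Y ∈ ℝ^{I×J} and let U ∈ ℝ^{I×K} have orthonormal columns. Set G := UᵀY and A := Y Gᵀ = Y Yᵀ U, and assume A has full column rank K. If U′ ∈ ℝ^{I×K} has orthonormal columns and the column space of U′ equals the column space of A, then ‖Yᵀ U′‖_F² ≥ ‖Yᵀ U‖_F². (Single-block update step of HOQRI does not decrease the objective.) -/
open Matrix

noncomputable section

/-- Squared Frobenius norm of a real matrix: `‖M‖_F² = tr(Mᵀ M)`. -/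
def frobSq {I K : ℕ} (M : Matrix (Fin I) (Fin K) ℝ) : ℝ := Matrix.trace (Mᵀ * M)

/-- Column space of a matrix, i.e. the range of the linear map `x ↦ M x`. -/
def colSpace {I K : ℕ} (M : Matrix (Fin I) (Fin K) ℝ) : Submodule ℝ (Fin I → ℝ) :=
  LinearMap.range M.mulVecLin

theorem frobSq_nonneg {I K : ℕ} (M : Matrix (Fin I) (Fin K) ℝ) : 0 ≤ frobSq M := by
  simpa [frobSq] using (Matrix.posSemidef_conjTranspose_mul_self M).trace_nonneg

/-- A matrix with orthonormal columns acts as an orthogonal projection onto its column space. -/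
theorem mul_transpose_mul_eq_of_colSpace_le {I K L : ℕ} {V : Matrix (Fin I) (Fin K) ℝ}
    {A : Matrix (Fin I) (Fin L) ℝ} (hV : Vᵀ * V = 1) (h : colSpace A ≤ colSpace V) :
    V * (Vᵀ * A) = A := by
  refine Matrix.ext_of_mulVec_single fun j => ?_
  obtain ⟨x, hx⟩ := h (LinearMap.mem_range_self A.mulVecLin (Pi.single j 1))
  simp only [Matrix.mulVecLin_apply] at hx
  rw [← Matrix.mulVec_mulVec, ← Matrix.mulVec_mulVec, ← hx, Matrix.mulVec_mulVec x Vᵀ V, hV,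
    Matrix.one_mulVec]

theorem isUnit_transpose_mul_self {J K : ℕ} {C : Matrix (Fin J) (Fin K) ℝ}
    (hC : Function.Injective C.mulVec) : IsUnit (Cᵀ * C) := by
  rw [← Matrix.mulVec_injective_iff_isUnit]
  refine (injective_iff_map_eq_zero (Cᵀ * C).mulVecLin).2 fun x hx => ?_
  have hx' : C *ᵥ x = 0 := by
    refine (Matrix.conjTranspose_mul_self_mulVec_eq_zero C x).1 ?_
    rwa [Matrix.conjTranspose_eq_transpose_of_trivial]
  exact hC (by simpa using hx')

/-- Single-block update step of HOQRI does not decrease the objective.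
Let `U` have orthonormal columns, `G := Uᵀ Y`, `A := Y Gᵀ = Y Yᵀ U` have full column
rank. If `U'` has orthonormal columns and the column space of `U'` equals the column
space of `A`, then `‖Yᵀ U'‖_F² ≥ ‖Yᵀ U‖_F²`. -/
theorem hoqri_step_monotone {I J K : ℕ} (Y : Matrix (Fin I) (Fin J) ℝ)
    (U U' : Matrix (Fin I) (Fin K) ℝ)
    (hU : Uᵀ * U = 1) (hU' : U'ᵀ * U' = 1)
    (hrank : Function.Injective (Y * (Uᵀ * Y)ᵀ).mulVecLin)
    (hcol : colSpace U' = colSpace (Y * (Uᵀ * Y)ᵀ)) :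
    frobSq (Yᵀ * U) ≤ frobSq (Yᵀ * U') := by
  set C := Yᵀ * U with hC
  set C' := Yᵀ * U' with hC'
  have hG : (Uᵀ * Y)ᵀ = C := by simp [hC]
  rw [hG] at hrank hcol
  set A := Y * C with hA
  set B := Cᵀ * C with hB
  have hCinj : Function.Injective C.mulVec := fun x y hxy => hrank (by
    simp only [Matrix.mulVecLin_apply, hA, ← Matrix.mulVec_mulVec, hxy])
  have hdet : IsUnit B.det := (Matrix.isUnit_iff_isUnit_det B).1 (isUnit_transpose_mul_self hCinj)
  have hBt : Bᵀ = B := by simp [hB]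
  set L := B⁻¹ with hL
  have hLt : Lᵀ = L := by rw [hL, Matrix.transpose_nonsing_inv, hBt]
  have hBL : B * L = 1 := Matrix.mul_nonsing_inv B hdet
  have hLB : L * B = 1 := Matrix.nonsing_inv_mul B hdet
  have hUA : Uᵀ * A = B := by simp [hA, hB, hC, Matrix.mul_assoc]
  have hAU : Aᵀ * U = B := by rw [← hBt, ← hUA]; simp
  have hproj : U' * (U'ᵀ * A) = A := mul_transpose_mul_eq_of_colSpace_le hU' hcol.ge
  set R := U'ᵀ * A with hR
  have hRC : C'ᵀ * C = R := by simp [hR, hA, hC', Matrix.mul_assoc]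
  have hCR : Cᵀ * C' = Rᵀ := by rw [← hRC]; simp
  have upper : Matrix.trace (R * L * Rᵀ) ≤ frobSq C' := by
    have h := frobSq_nonneg (C' - C * (L * Rᵀ))
    have e : (C' - C * (L * Rᵀ))ᵀ * (C' - C * (L * Rᵀ)) = C'ᵀ * C' - R * L * Rᵀ := by
      calc _ = C'ᵀ * C' - (C'ᵀ * C) * L * Rᵀ - R * L * (Cᵀ * C') + R * (L * B) * L * Rᵀ := by
            simp only [Matrix.transpose_sub, Matrix.transpose_mul, Matrix.transpose_transpose, hLt,
              Matrix.sub_mul, Matrix.mul_sub, Matrix.mul_assoc, hB]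
            abel
        _ = _ := by rw [hRC, hCR, hLB, Matrix.mul_one]; abel
    rw [frobSq, e, Matrix.trace_sub] at h
    rw [frobSq]
    linarith
  have lower : Matrix.trace B ≤ Matrix.trace (R * L * Rᵀ) := by
    have h := frobSq_nonneg (C * (L * (A - U * B)ᵀ))
    have e : (C * (L * (A - U * B)ᵀ))ᵀ * (C * (L * (A - U * B)ᵀ)) =
        A * L * Aᵀ - A * Uᵀ - U * Aᵀ + U * (B * Uᵀ) := by
      calc _ = (A - U * B) * (L * B) * L * (A - U * B)ᵀ := by
            simp only [Matrix.transpose_mul, Matrix.transpose_transpose, hLt, Matrix.mul_assoc, hB]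
        _ = A * L * Aᵀ - A * (L * B) * Uᵀ - U * (B * L) * Aᵀ + U * (B * L) * B * Uᵀ := by
            rw [hLB, Matrix.mul_one]
            simp only [Matrix.transpose_sub, Matrix.transpose_mul, hBt, Matrix.sub_mul,
              Matrix.mul_sub, Matrix.mul_assoc, ← Matrix.mul_assoc L B, hLB, Matrix.one_mul]
            simp only [← Matrix.mul_assoc B L, hBL, Matrix.one_mul]
            abel
        _ = _ := by rw [hLB, hBL]; simp only [Matrix.mul_one, Matrix.mul_assoc]
    have t1 : Matrix.trace (A * L * Aᵀ) = Matrix.trace (R * L * Rᵀ) := by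
      calc _ = Matrix.trace (U' * (R * L * Rᵀ * U'ᵀ)) := by
            rw [← hproj]
            simp only [Matrix.transpose_mul, Matrix.mul_assoc]
        _ = _ := by rw [Matrix.trace_mul_comm, Matrix.mul_assoc, hU', Matrix.mul_one]
    have t2 : Matrix.trace (A * Uᵀ) = Matrix.trace B := by rw [Matrix.trace_mul_comm, hUA]
    have t3 : Matrix.trace (U * Aᵀ) = Matrix.trace B := by rw [Matrix.trace_mul_comm, hAU]
    have t4 : Matrix.trace (U * (B * Uᵀ)) = Matrix.trace B := by
      rw [Matrix.trace_mul_comm, Matrix.mul_assoc, hU, Matrix.mul_one]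
    rw [frobSq, e, Matrix.trace_add, Matrix.trace_sub, Matrix.trace_sub, t1, t2, t3, t4] at h
    linarith
  exact lower.trans upper
end
end

section
/- Theorem 1 (objective monotonicity of HOQRI). Let X be an N-way tensor and let {U_t}_{t≥0} be HOQRI iterates, where at each step the TTMcTC matrix of the updated block is assumed to have full column rank. Then f({U_{t+1}}) ≥ f({U_t}) for all t = 0, 1, 2, …. -/
open Matrix Finset

noncomputable section

/-- The Tucker core tensor: `G(k) = ∑_i X(i) ∏_n U⁽ⁿ⁾(iₙ, kₙ)`. -/
def core {N : ℕ} {Idim Kdim : Fin N → ℕ} (X : (∀ n, Fin (Idim n)) → ℝ)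
    (U : ∀ n, Matrix (Fin (Idim n)) (Fin (Kdim n)) ℝ) :
    (∀ n, Fin (Kdim n)) → ℝ :=
  fun k => ∑ i : ∀ n, Fin (Idim n), X i * ∏ n, U n (i n) (k n)

/-- The Tucker objective `f({U}) = ∑_k G(k)²`, the squared norm of the core. -/
def obj {N : ℕ} {Idim Kdim : Fin N → ℕ} (X : (∀ n, Fin (Idim n)) → ℝ)
    (U : ∀ n, Matrix (Fin (Idim n)) (Fin (Kdim n)) ℝ) : ℝ :=
  ∑ k : ∀ n, Fin (Kdim n), (core X U k) ^ 2

/-- The mode-`n` TTMcTC matrix `A⁽ⁿ⁾`, with entries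
`A⁽ⁿ⁾(a,b) = ∑_{i : iₙ = a} ∑_{k : kₙ = b} X(i) G(k) ∏_{ν ≠ n} U⁽ᵛ⁾(i_ν, k_ν)`. -/
def ttmctc {N : ℕ} {Idim Kdim : Fin N → ℕ} (X : (∀ n, Fin (Idim n)) → ℝ)
    (n : Fin N) (U : ∀ m, Matrix (Fin (Idim m)) (Fin (Kdim m)) ℝ) :
    Matrix (Fin (Idim n)) (Fin (Kdim n)) ℝ :=
  Matrix.of fun a b =>
    ∑ i : ∀ ν, Fin (Idim ν), ∑ k : ∀ ν, Fin (Kdim ν),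
      if i n = a ∧ k n = b then
        X i * core X U k * ∏ ν ∈ Finset.univ.erase n, U ν (i ν) (k ν)
      else 0

/-- The mode-`n` Gram matrix of the core, `M⁽ⁿ⁾ = G₍ₙ₎ G₍ₙ₎ᵀ`, with entries
`M⁽ⁿ⁾(a,b) = ∑_{k_ν, ν≠n} G(…,a,…) G(…,b,…)`. -/
def gramCore {N : ℕ} {Idim Kdim : Fin N → ℕ} (X : (∀ n, Fin (Idim n)) → ℝ)
    (n : Fin N) (U : ∀ m, Matrix (Fin (Idim m)) (Fin (Kdim m)) ℝ) :
    Matrix (Fin (Kdim n)) (Fin (Kdim n)) ℝ :=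
  Matrix.of fun a b =>
    ∑ k : ∀ ν, Fin (Kdim ν),
      if k n = a then core X U k * core X U (Function.update k n b) else 0

/-- The block updated at step `t` of HOQRI: `n_t = (t mod N) + 1` (here 0-indexed as
`t mod N`). -/
def blockAt {N : ℕ} (hN : 0 < N) (t : ℕ) : Fin N := ⟨t % N, Nat.mod_lt t hN⟩

/-- `U : ℕ → …` is a sequence of HOQRI iterates: the initial factors have orthonormal
columns, and at each step `t` the block `n_t = (t mod N) + 1` is replaced by a matrix
with orthonormal columns whose column space equals the column space of the TTMcTC
matrix `A⁽ⁿᵗ⁾` computed at `{U_t}` (assumed to have full column rank), while all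
other blocks are unchanged. -/
def IsHOQRI {N : ℕ} (hN : 0 < N) {Idim Kdim : Fin N → ℕ}
    (X : (∀ n, Fin (Idim n)) → ℝ)
    (U : ℕ → ∀ n, Matrix (Fin (Idim n)) (Fin (Kdim n)) ℝ) : Prop :=
  (∀ n, (U 0 n)ᵀ * U 0 n = 1) ∧
  ∀ t : ℕ,
    ((U (t + 1) (blockAt hN t))ᵀ * U (t + 1) (blockAt hN t) = 1) ∧
    Function.Injective (ttmctc X (blockAt hN t) (U t)).mulVecLin ∧
    LinearMap.range (U (t + 1) (blockAt hN t)).mulVecLin =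
      LinearMap.range (ttmctc X (blockAt hN t) (U t)).mulVecLin ∧
    ∀ m : Fin N, m ≠ blockAt hN t → U (t + 1) m = U t m

theorem trace_transpose_mul_self_eq_sum_sq {m n : Type*} [Fintype m] [Fintype n]
    (Z : Matrix m n ℝ) : trace (Zᵀ * Z) = ∑ i, ∑ j, Z i j ^ 2 := by
  rw [Finset.sum_comm]
  simp [trace, mul_apply, sq]

theorem trace_transpose_mul_self_nonneg {m n : Type*} [Fintype m] [Fintype n]
    (Z : Matrix m n ℝ) : 0 ≤ trace (Zᵀ * Z) := by
  rw [trace_transpose_mul_self_eq_sum_sq]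
  positivity

/-- An orthogonal projection does not increase the Frobenius norm. -/
theorem trace_projection_le {m n : Type*} [Fintype m] [Fintype n] {Q : Matrix m m ℝ}
    (hsymm : Qᵀ = Q) (hidem : Q * Q = Q) (Z : Matrix m n ℝ) :
    trace ((Q * Z)ᵀ * (Q * Z)) ≤ trace (Zᵀ * Z) := by
  have h := trace_transpose_mul_self_nonneg (Z - Q * Z)
  have hQ : (Q * Z)ᵀ * (Q * Z) = Zᵀ * (Q * Z) := by
    rw [transpose_mul, hsymm, Matrix.mul_assoc, ← Matrix.mul_assoc Q, hidem]
  have hQ' : (Q * Z)ᵀ * Z = Zᵀ * (Q * Z) := by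
    rw [transpose_mul, hsymm, Matrix.mul_assoc]
  rw [transpose_sub, Matrix.sub_mul, Matrix.mul_sub, Matrix.mul_sub, hQ, hQ'] at h
  rw [hQ]
  simpa using h

/-- Multiplying by a matrix with orthonormal columns preserves the Frobenius norm. -/
theorem trace_orthonormal_mul {m n k : Type*} [Fintype m] [Fintype n] [Fintype k]
    [DecidableEq k] {V : Matrix m k ℝ} (hV : Vᵀ * V = 1) (Z : Matrix k n ℝ) :
    trace ((V * Z)ᵀ * (V * Z)) = trace (Zᵀ * Z) := by
  rw [transpose_mul, Matrix.mul_assoc, ← Matrix.mul_assoc Vᵀ, hV, Matrix.one_mul]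

theorem trace_orthonormal_transpose_mul_le {m n k : Type*} [Fintype m] [Fintype n] [Fintype k]
    [DecidableEq k] {V : Matrix m k ℝ} (hV : Vᵀ * V = 1) (Z : Matrix m n ℝ) :
    trace ((Vᵀ * Z)ᵀ * (Vᵀ * Z)) ≤ trace (Zᵀ * Z) := by
  rw [← trace_orthonormal_mul hV, ← Matrix.mul_assoc V]
  have hsymm : (V * Vᵀ)ᵀ = V * Vᵀ := by rw [transpose_mul, transpose_transpose]
  refine trace_projection_le hsymm ?_ Z
  rw [Matrix.mul_assoc, ← Matrix.mul_assoc Vᵀ, hV, Matrix.one_mul]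

/-- A matrix with orthonormal columns acts as the orthogonal projection onto its range. -/
theorem orthonormal_mul_transpose_mul_of_range_eq {m k : Type*} [Fintype m] [Fintype k]
    [DecidableEq k] {V A : Matrix m k ℝ} (hV : Vᵀ * V = 1)
    (hrange : LinearMap.range V.mulVecLin = LinearMap.range A.mulVecLin) :
    V * (Vᵀ * A) = A := by
  refine Matrix.ext_of_mulVec_single fun j => ?_
  obtain ⟨y, hy⟩ : A *ᵥ Pi.single j 1 ∈ LinearMap.range V.mulVecLin :=
    hrange ▸ ⟨Pi.single j 1, rfl⟩
  rw [mulVecLin_apply] at hy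
  rw [← mulVec_mulVec, ← mulVec_mulVec, ← hy, mulVec_mulVec y Vᵀ V, hV, one_mulVec]

/-- One orthogonal iteration step for `Y * Yᵀ` does not decrease the norm of the projected data. -/
theorem trace_orthogonal_iteration_le {m n k : Type*} [Fintype m] [Fintype n] [Fintype k]
    [DecidableEq k] {U V : Matrix m k ℝ} {Y : Matrix m n ℝ} (hU : Uᵀ * U = 1) (hV : Vᵀ * V = 1)
    (hinj : Function.Injective (Y * (Uᵀ * Y)ᵀ).mulVecLin)
    (hrange : LinearMap.range V.mulVecLin = LinearMap.range (Y * (Uᵀ * Y)ᵀ).mulVecLin) :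
    trace ((Uᵀ * Y)ᵀ * (Uᵀ * Y)) ≤ trace ((Vᵀ * Y)ᵀ * (Vᵀ * Y)) := by
  have hVA := orthonormal_mul_transpose_mul_of_range_eq hV hrange
  set G := Uᵀ * Y with hG
  set M := G * Gᵀ with hM
  have hMunit : IsUnit M := by
    rw [← mulVec_injective_iff_isUnit]
    refine (injective_iff_map_eq_zero M.mulVecLin).2 ?_
    intro x hx
    have hGx : Gᵀ *ᵥ x = 0 := by
      have h : ((Gᵀ)ᴴ * Gᵀ) *ᵥ x = 0 := by
        rwa [conjTranspose_eq_transpose_of_trivial, transpose_transpose]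
      exact (conjTranspose_mul_self_mulVec_eq_zero _ _).1 h
    refine hinj ?_
    simp only [mulVecLin_apply, ← mulVec_mulVec, hGx, mulVec_zero]
  have hMdet : IsUnit M.det := (isUnit_iff_isUnit_det M).1 hMunit
  have hMsymm : (M⁻¹)ᵀ = M⁻¹ := by
    rw [transpose_nonsing_inv]
    simp [hM]
  set P := Gᵀ * M⁻¹ * G with hP
  have hPsymm : Pᵀ = P := by simp [hP, hMsymm, Matrix.mul_assoc]
  have hPidem : P * P = P := by
    calc P * P = Gᵀ * M⁻¹ * (M * M⁻¹) * G := by simp only [hP, hM, Matrix.mul_assoc]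
      _ = P := by rw [mul_nonsing_inv _ hMdet, Matrix.mul_one]
  have hUT : Uᵀ * (Y * P) = G := by
    calc Uᵀ * (Y * P) = M * M⁻¹ * G := by simp only [hP, hM, hG, Matrix.mul_assoc]
      _ = G := by rw [mul_nonsing_inv _ hMdet, Matrix.one_mul]
  have hVT : V * (Vᵀ * Y * P) = Y * P := by
    calc V * (Vᵀ * Y * P) = V * (Vᵀ * (Y * Gᵀ)) * (M⁻¹ * G) := by
          simp only [hP, Matrix.mul_assoc]
      _ = Y * P := by rw [hVA]; simp only [hP, Matrix.mul_assoc]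
  calc trace (Gᵀ * G) = trace ((Uᵀ * (Y * P))ᵀ * (Uᵀ * (Y * P))) := by rw [hUT]
    _ ≤ trace ((Y * P)ᵀ * (Y * P)) := trace_orthonormal_transpose_mul_le hU _
    _ = trace ((Vᵀ * Y * P)ᵀ * (Vᵀ * Y * P)) := by rw [← trace_orthonormal_mul hV, hVT]
    _ = trace ((P * (Vᵀ * Y)ᵀ)ᵀ * (P * (Vᵀ * Y)ᵀ)) := by
        rw [trace_mul_comm]
        simp [hPsymm, Matrix.mul_assoc]
    _ ≤ trace ((Vᵀ * Y)ᵀᵀ * (Vᵀ * Y)ᵀ) := trace_projection_le hPsymm hPidem _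
    _ = trace ((Vᵀ * Y)ᵀ * (Vᵀ * Y)) := by rw [trace_mul_comm, transpose_transpose]

/-- The mode-`n` unfolding of the tensor contracted with all factors except the `n`-th. -/
def partialUnfolding {N : ℕ} {Idim Kdim : Fin N → ℕ} (X : (∀ n, Fin (Idim n)) → ℝ)
    (n : Fin N) (U : ∀ m, Matrix (Fin (Idim m)) (Fin (Kdim m)) ℝ) :
    Matrix (Fin (Idim n)) (∀ ν : {ν // ν ≠ n}, Fin (Kdim ν)) ℝ :=
  Matrix.of fun a κ => ∑ i : ∀ ν, Fin (Idim ν),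
    if i n = a then X i * ∏ ν : {ν // ν ≠ n}, U ν (i ν) (κ ν) else 0

section Unfolding

variable {N : ℕ} {Idim Kdim : Fin N → ℕ}

theorem partialUnfolding_congr (X : (∀ n, Fin (Idim n)) → ℝ) (n : Fin N)
    {U W : ∀ m, Matrix (Fin (Idim m)) (Fin (Kdim m)) ℝ} (h : ∀ m, m ≠ n → W m = U m) :
    partialUnfolding X n W = partialUnfolding X n U := by
  ext a κ
  simp only [partialUnfolding, of_apply]
  refine Finset.sum_congr rfl fun i _ => ?_
  rw [Finset.prod_congr rfl fun (ν : {ν // ν ≠ n}) _ => by rw [h ν ν.2]]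

theorem prod_erase_eq_prod_subtype_ne (n : Fin N) (f : Fin N → ℝ) :
    ∏ ν ∈ univ.erase n, f ν = ∏ ν : {ν // ν ≠ n}, f ν :=
  Finset.prod_subtype _ (by simp) f

theorem core_eq_mul_partialUnfolding (X : (∀ n, Fin (Idim n)) → ℝ) (n : Fin N)
    (U : ∀ m, Matrix (Fin (Idim m)) (Fin (Kdim m)) ℝ) (k : ∀ m, Fin (Kdim m)) :
    core X U k = ((U n)ᵀ * partialUnfolding X n U) (k n) (fun ν => k ν) := by
  simp only [core, mul_apply, partialUnfolding, of_apply, transpose_apply, Finset.mul_sum]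
  rw [Finset.sum_comm]
  refine Finset.sum_congr rfl fun i _ => ?_
  rw [← Finset.mul_prod_erase _ _ (Finset.mem_univ n), prod_erase_eq_prod_subtype_ne]
  simp [mul_left_comm]

theorem sum_eq_sum_piSplitAt (n : Fin N) (F : Fin (Kdim n) →
    (∀ ν : {ν // ν ≠ n}, Fin (Kdim ν)) → ℝ) :
    ∑ k : ∀ m, Fin (Kdim m), F (k n) (fun ν => k ν) = ∑ b, ∑ κ, F b κ := by
  rw [← Fintype.sum_prod_type']
  exact Fintype.sum_equiv (Equiv.piSplitAt n fun m => Fin (Kdim m)) _ _ fun k => rfl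

theorem obj_eq_trace (X : (∀ n, Fin (Idim n)) → ℝ) (n : Fin N)
    (U : ∀ m, Matrix (Fin (Idim m)) (Fin (Kdim m)) ℝ) :
    obj X U = trace (((U n)ᵀ * partialUnfolding X n U)ᵀ *
      ((U n)ᵀ * partialUnfolding X n U)) := by
  rw [trace_transpose_mul_self_eq_sum_sq, ← sum_eq_sum_piSplitAt]
  simp only [obj, core_eq_mul_partialUnfolding X n U]

theorem ttmctc_eq_mul (X : (∀ n, Fin (Idim n)) → ℝ) (n : Fin N)
    (U : ∀ m, Matrix (Fin (Idim m)) (Fin (Kdim m)) ℝ) :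
    ttmctc X n U = partialUnfolding X n U * ((U n)ᵀ * partialUnfolding X n U)ᵀ := by
  ext a b
  set G := (U n)ᵀ * partialUnfolding X n U with hG
  rw [mul_apply]
  simp only [ttmctc, partialUnfolding, of_apply, transpose_apply, Finset.sum_mul]
  rw [Finset.sum_comm (s := univ (α := ∀ ν : {ν // ν ≠ n}, Fin (Kdim ν)))]
  refine Finset.sum_congr rfl fun i _ => ?_
  simp only [prod_erase_eq_prod_subtype_ne, core_eq_mul_partialUnfolding X n U, ← hG]
  rw [sum_eq_sum_piSplitAt n fun c κ => if i n = a ∧ c = b then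
    X i * G c κ * ∏ ν : {ν // ν ≠ n}, U ν (i ν) (κ ν) else 0, Finset.sum_comm]
  refine Finset.sum_congr rfl fun κ _ => ?_
  by_cases hi : i n = a
  · simp [hi, mul_right_comm]
  · simp [hi]

end Unfolding

theorem IsHOQRI.orthonormal {N : ℕ} {hN : 0 < N} {Idim Kdim : Fin N → ℕ}
    {X : (∀ n, Fin (Idim n)) → ℝ} {U : ℕ → ∀ n, Matrix (Fin (Idim n)) (Fin (Kdim n)) ℝ}
    (hU : IsHOQRI hN X U) (t : ℕ) (n : Fin N) : (U t n)ᵀ * U t n = 1 := by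
  induction t generalizing n with
  | zero => exact hU.1 n
  | succ t ih =>
    obtain ⟨horth, -, -, heq⟩ := hU.2 t
    by_cases h : n = blockAt hN t
    · exact h ▸ horth
    · rw [heq n h]
      exact ih n

/-- Theorem 1 (objective monotonicity of HOQRI): along HOQRI iterates,
`f({U_{t+1}}) ≥ f({U_t})` for all `t`. -/
theorem hoqri_objective_monotone {N : ℕ} (hN : 0 < N) {Idim Kdim : Fin N → ℕ}
    (X : (∀ n, Fin (Idim n)) → ℝ)
    (U : ℕ → ∀ n, Matrix (Fin (Idim n)) (Fin (Kdim n)) ℝ)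
    (hU : IsHOQRI hN X U) :
    ∀ t : ℕ, obj X (U t) ≤ obj X (U (t + 1)) := by
  intro t
  obtain ⟨horth, hinj, hrange, heq⟩ := hU.2 t
  rw [ttmctc_eq_mul] at hinj hrange
  rw [obj_eq_trace X (blockAt hN t) (U t), obj_eq_trace X (blockAt hN t) (U (t + 1)),
    partialUnfolding_congr X _ heq]
  exact trace_orthogonal_iteration_le (hU.orthonormal t _) horth hinj hrange
end
end

section
/- Lemma 1 (interlacing). Let Y ∈ ℝ^{I×J} and let U ∈ ℝ^{I×K} have orthonormal columns. Set G := UᵀY and A := Y Gᵀ = Y Yᵀ U. Let σ_1 ≥ … ≥ σ_K be the singular values of A in descending order, and let λ_1 ≥ … ≥ λ_K be the eigenvalues of the symmetric positive semidefinite matrix G Gᵀ in descending order. Then σ_k ≥ λ_k for every k = 1, …, K. -/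
open Matrix

noncomputable section

/-- Monotonicity of ordered eigenvalues: if one quadratic form, diagonal in an orthonormal basis
with antitone coefficients, is dominated by another, then so are its coefficients. -/
theorem OrthonormalBasis.coeff_le_of_sum_sq_inner_le {n : ℕ} {E : Type*}
    [NormedAddCommGroup E] [InnerProductSpace ℝ E]
    (c d : OrthonormalBasis (Fin n) ℝ E) {a b : Fin n → ℝ} (ha : Antitone a) (hb : Antitone b)
    (h : ∀ x, ∑ i, a i * inner ℝ (c i) x ^ 2 ≤ ∑ i, b i * inner ℝ (d i) x ^ 2) (k : Fin n) :
    a k ≤ b k := by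
  have : FiniteDimensional ℝ E := c.toBasis.finiteDimensional_of_finite
  let f : E →ₗ[ℝ] ({j : Fin n // j ≠ k} → ℝ) :=
    LinearMap.pi fun j => innerₛₗ ℝ (if j.1 < k then d j.1 else c j.1)
  have hf : LinearMap.ker f ≠ ⊥ := by
    apply LinearMap.ker_ne_bot_of_finrank_lt
    rw [Module.finrank_eq_card_basis c.toBasis, Module.finrank_fintype_fun_eq_card]
    exact Fintype.card_subtype_lt (x := k) (by simp)
  obtain ⟨x, hx, hx0⟩ := Submodule.exists_mem_ne_zero_of_ne_bot hf
  have hfx (j : Fin n) (hj : j ≠ k) : inner ℝ (if j < k then d j else c j) x = 0 :=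
    congrFun (LinearMap.mem_ker.mp hx) ⟨j, hj⟩
  have hlow : a k * ‖x‖ ^ 2 ≤ ∑ i, a i * inner ℝ (c i) x ^ 2 := by
    rw [← c.sum_sq_inner_right x, Finset.mul_sum]
    refine Finset.sum_le_sum fun i _ => ?_
    rcases le_or_gt i k with hi | hi
    · exact mul_le_mul_of_nonneg_right (ha hi) (sq_nonneg _)
    · have := hfx i hi.ne'
      rw [if_neg hi.not_gt] at this
      simp [this]
  have hup : ∑ i, b i * inner ℝ (d i) x ^ 2 ≤ b k * ‖x‖ ^ 2 := by
    rw [← d.sum_sq_inner_right x, Finset.mul_sum]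
    refine Finset.sum_le_sum fun i _ => ?_
    rcases le_or_gt k i with hi | hi
    · exact mul_le_mul_of_nonneg_right (hb hi) (sq_nonneg _)
    · have := hfx i hi.ne
      rw [if_pos hi] at this
      simp [this]
  exact le_of_mul_le_mul_right (hlow.trans ((h x).trans hup)) (by positivity)

namespace Matrix

variable {m n : Type*} [Fintype m] [Fintype n] [DecidableEq n]

theorem IsHermitian.inner_eigenvectorBasis_mulVec {M : Matrix n n ℝ} (hM : M.IsHermitian)
    (x : EuclideanSpace ℝ n) (i : n) :
    inner ℝ (hM.eigenvectorBasis i) (WithLp.toLp 2 (M *ᵥ x.ofLp)) =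
      hM.eigenvalues i * inner ℝ (hM.eigenvectorBasis i) x := by
  have hT : Mᵀ = M := by simpa using hM.eq
  simp only [EuclideanSpace.inner_eq_star_dotProduct, star_trivial]
  rw [dotProduct_comm, dotProduct_mulVec, ← mulVec_transpose, hT, hM.mulVec_eigenvectorBasis,
    smul_dotProduct, smul_eq_mul, dotProduct_comm]

theorem IsHermitian.sum_eigenvalues_mul_sq_inner {M : Matrix n n ℝ} (hM : M.IsHermitian)
    (x : EuclideanSpace ℝ n) :
    ∑ i, hM.eigenvalues i * inner ℝ (hM.eigenvectorBasis i) x ^ 2 =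
      x.ofLp ⬝ᵥ (M *ᵥ x.ofLp) := by
  have := hM.eigenvectorBasis.sum_inner_mul_inner x (WithLp.toLp 2 (M *ᵥ x.ofLp))
  rw [EuclideanSpace.inner_eq_star_dotProduct, star_trivial, dotProduct_comm] at this
  rw [← this]
  refine Finset.sum_congr rfl fun i _ => ?_
  rw [hM.inner_eigenvectorBasis_mulVec, real_inner_comm]
  ring

theorem IsHermitian.sum_sq_eigenvalues_mul_sq_inner {M : Matrix n n ℝ} (hM : M.IsHermitian)
    (x : EuclideanSpace ℝ n) :
    ∑ i, hM.eigenvalues i ^ 2 * inner ℝ (hM.eigenvectorBasis i) x ^ 2 =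
      (M *ᵥ x.ofLp) ⬝ᵥ (M *ᵥ x.ofLp) := by
  have := hM.eigenvectorBasis.sum_inner_mul_inner (WithLp.toLp 2 (M *ᵥ x.ofLp))
    (WithLp.toLp 2 (M *ᵥ x.ofLp))
  rw [EuclideanSpace.inner_eq_star_dotProduct, star_trivial] at this
  rw [← this]
  refine Finset.sum_congr rfl fun i _ => ?_
  rw [real_inner_comm (hM.eigenvectorBasis i) (WithLp.toLp 2 _),
    hM.inner_eigenvectorBasis_mulVec]
  ring

theorem dotProduct_transpose_mulVec_self_le {U : Matrix m n ℝ} (hU : Uᵀ * U = 1) (w : m → ℝ) :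
    (Uᵀ *ᵥ w) ⬝ᵥ (Uᵀ *ᵥ w) ≤ w ⬝ᵥ w := by
  have h := dotProduct_self_star_nonneg (w - U *ᵥ (Uᵀ *ᵥ w))
  have h₁ : w ⬝ᵥ (U *ᵥ (Uᵀ *ᵥ w)) = (Uᵀ *ᵥ w) ⬝ᵥ (Uᵀ *ᵥ w) := by
    rw [dotProduct_mulVec, ← mulVec_transpose]
  have h₂ : (U *ᵥ (Uᵀ *ᵥ w)) ⬝ᵥ (U *ᵥ (Uᵀ *ᵥ w)) = (Uᵀ *ᵥ w) ⬝ᵥ (Uᵀ *ᵥ w) := by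
    rw [dotProduct_mulVec, ← mulVec_transpose, mulVec_mulVec, hU, one_mulVec]
  rw [star_trivial, sub_dotProduct, dotProduct_sub, dotProduct_sub, h₂,
    dotProduct_comm (U *ᵥ (Uᵀ *ᵥ w)) w, h₁] at h
  linarith

end Matrix

/-- Lemma 1 (interlacing). Let `U` have orthonormal columns, `G := Uᵀ Y`,
`A := Y Gᵀ = Y Yᵀ U`. If `σ₁ ≥ … ≥ σ_K` are the singular values of `A`
(the square roots of the eigenvalues of `Aᵀ A`) in descending order, and
`λ₁ ≥ … ≥ λ_K` are the eigenvalues of the symmetric PSD matrix `G Gᵀ` in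
descending order, then `σ_k ≥ λ_k` for every `k`. -/
theorem interlacing_singular_ge_eigen {I J K : ℕ}
    (Y : Matrix (Fin I) (Fin J) ℝ) (U : Matrix (Fin I) (Fin K) ℝ)
    (hU : Uᵀ * U = 1)
    (G : Matrix (Fin K) (Fin J) ℝ) (hG : G = Uᵀ * Y)
    (A : Matrix (Fin I) (Fin K) ℝ) (hA : A = Y * Gᵀ)
    (hAH : (Aᵀ * A).IsHermitian) (hGH : (G * Gᵀ).IsHermitian)
    (σ lam : Fin K → ℝ) (hσmono : Antitone σ) (hlmono : Antitone lam)
    (eσ : Fin K ≃ Fin K) (hσ : ∀ k, σ k = Real.sqrt (hAH.eigenvalues (eσ k)))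
    (el : Fin K ≃ Fin K) (hl : ∀ k, lam k = hGH.eigenvalues (el k)) :
    ∀ k, lam k ≤ σ k := by
  have hB : G * Gᵀ = Uᵀ * A := by rw [hA, ← Matrix.mul_assoc, ← hG]
  have hpos : (G * Gᵀ).PosSemidef := by
    simpa using posSemidef_self_mul_conjTranspose G
  have hl0 (k) : 0 ≤ lam k := hl k ▸ hpos.eigenvalues_nonneg _
  have hσ0 (k) : 0 ≤ σ k := hσ k ▸ Real.sqrt_nonneg _
  have hAA : (Aᵀ * A).PosSemidef := by
    simpa using posSemidef_conjTranspose_mul_self A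
  have hσsq (k) : σ k ^ 2 = hAH.eigenvalues (eσ k) := by
    rw [hσ, Real.sq_sqrt (hAA.eigenvalues_nonneg _)]
  intro k
  refine le_of_sq_le_sq ?_ (hσ0 k)
  refine (hGH.eigenvectorBasis.reindex el.symm).coeff_le_of_sum_sq_inner_le
    (hAH.eigenvectorBasis.reindex eσ.symm) (a := fun k => lam k ^ 2) (b := fun k => σ k ^ 2)
    (fun i j hij => pow_le_pow_left₀ (hl0 j) (hlmono hij) 2)
    (fun i j hij => pow_le_pow_left₀ (hσ0 j) (hσmono hij) 2) (fun x => ?_) k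
  simp only [OrthonormalBasis.reindex_apply, Equiv.symm_symm, hσsq, hl]
  rw [el.sum_comp fun i => hGH.eigenvalues i ^ 2 * inner ℝ (hGH.eigenvectorBasis i) x ^ 2,
    eσ.sum_comp fun i => hAH.eigenvalues i * inner ℝ (hAH.eigenvectorBasis i) x ^ 2,
    hGH.sum_sq_eigenvalues_mul_sq_inner, hAH.sum_eigenvalues_mul_sq_inner, hB,
    ← mulVec_mulVec, ← mulVec_mulVec, dotProduct_mulVec x.ofLp, ← mulVec_transpose,
    transpose_transpose]
  exact dotProduct_transpose_mulVec_self_le hU _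
end
end

section
/- Key per-iteration inequality (matrix form). Let Y ∈ ℝ^{I×J} and let U ∈ ℝ^{I×K} have orthonormal columns. Set G := UᵀY and A := Y Gᵀ = Y Yᵀ U, and assume A has full column rank K. If U′ ∈ ℝ^{I×K} has orthonormal columns and the column space of U′ equals the column space of A, then ‖A − U G Gᵀ‖_F² ≤ ‖YᵀU′‖_F² · ( ‖YᵀU′‖_F² − ‖YᵀU‖_F² ). In particular, the squared norm of the Riemannian gradient block is bounded by the per-iteration improvement of the objective times the new objective value. -/
open Matrix

noncomputable section

theorem frobSq_eq_sum {I K : ℕ} (M : Matrix (Fin I) (Fin K) ℝ) :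
    frobSq M = ∑ i, ∑ j, M i j ^ 2 := by
  rw [Finset.sum_comm]
  simp [frobSq, Matrix.trace, Matrix.mul_apply, sq]

theorem frobSq_transpose {I K : ℕ} (M : Matrix (Fin I) (Fin K) ℝ) : frobSq Mᵀ = frobSq M := by
  rw [frobSq, frobSq, transpose_transpose, Matrix.trace_mul_comm]

/-- The squared Frobenius norm is submultiplicative. -/
theorem frobSq_mul_le {I J K : ℕ} (M : Matrix (Fin I) (Fin J) ℝ) (N : Matrix (Fin J) (Fin K) ℝ) :
    frobSq (M * N) ≤ frobSq M * frobSq N := by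
  simp only [frobSq_eq_sum]
  rw [Finset.sum_comm (f := fun i j => N i j ^ 2), Finset.sum_mul_sum]
  gcongr with i _ k _
  rw [Matrix.mul_apply]
  exact Finset.sum_mul_sq_le_sq_mul_sq _ _ _

/-- Left multiplication by a matrix with orthonormal columns preserves the Frobenius norm. -/
theorem frobSq_orthonormal_mul {I J K : ℕ} {U : Matrix (Fin I) (Fin J) ℝ} (hU : Uᵀ * U = 1)
    (M : Matrix (Fin J) (Fin K) ℝ) : frobSq (U * M) = frobSq M := by
  rw [frobSq, frobSq, transpose_mul, Matrix.mul_assoc, ← Matrix.mul_assoc Uᵀ, hU, Matrix.one_mul]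

/-- Pythagorean theorem for the Frobenius norm. -/
theorem frobSq_add_of_orthogonal {I K : ℕ} {M N : Matrix (Fin I) (Fin K) ℝ} (h : Mᵀ * N = 0) :
    frobSq (M + N) = frobSq M + frobSq N := by
  have h' : Nᵀ * M = 0 := by simpa using congrArg transpose h
  simp [frobSq, Matrix.add_mul, Matrix.mul_add, h, h']

/-- The Gram matrix of a matrix with linearly independent rows is invertible. -/
theorem isUnit_det_mul_transpose {J K : ℕ} {G : Matrix (Fin K) (Fin J) ℝ}
    (h : Function.Injective Gᵀ.mulVec) : IsUnit (G * Gᵀ).det := by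
  rw [← Matrix.isUnit_iff_isUnit_det, ← Matrix.mulVec_injective_iff_isUnit]
  refine (injective_iff_map_eq_zero (G * Gᵀ).mulVecLin).2 fun x hx => h ?_
  have hx' : (Gᵀᵀ * Gᵀ) *ᵥ x = 0 := by rwa [transpose_transpose]
  rw [mulVec_zero]
  have := (Matrix.conjTranspose_mul_self_mulVec_eq_zero Gᵀ x).1
  rw [conjTranspose_eq_transpose_of_trivial] at this
  exact this hx'

/-- Key per-iteration inequality (matrix form). Let `U` have orthonormal columns,
`G := Uᵀ Y`, `A := Y Gᵀ = Y Yᵀ U` have full column rank. If `U'` has orthonormal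
columns and spans the column space of `A`, then
`‖A − U G Gᵀ‖_F² ≤ ‖Yᵀ U'‖_F² (‖Yᵀ U'‖_F² − ‖Yᵀ U‖_F²)`. -/
theorem key_per_iteration_inequality {I J K : ℕ}
    (Y : Matrix (Fin I) (Fin J) ℝ) (U U' : Matrix (Fin I) (Fin K) ℝ)
    (hU : Uᵀ * U = 1) (hU' : U'ᵀ * U' = 1)
    (G : Matrix (Fin K) (Fin J) ℝ) (hG : G = Uᵀ * Y)
    (A : Matrix (Fin I) (Fin K) ℝ) (hA : A = Y * Gᵀ)
    (hrank : Function.Injective A.mulVecLin)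
    (hcol : colSpace U' = colSpace A) :
    frobSq (A - U * (G * Gᵀ)) ≤ frobSq (Yᵀ * U') * (frobSq (Yᵀ * U') - frobSq (Yᵀ * U)) := by
  have hinj : Function.Injective Gᵀ.mulVec := fun x y hxy => hrank <| by
    simp only [mulVecLin_apply, hA, ← mulVec_mulVec, hxy]
  have hdet : IsUnit (G * Gᵀ).det := isUnit_det_mul_transpose hinj
  set H := G * Gᵀ with hH
  have hHt : Hᵀ = H := by rw [hH, transpose_mul, transpose_transpose]
  have hUA : Uᵀ * A = H := by rw [hA, ← Matrix.mul_assoc, ← hG]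
  have hGt : Yᵀ * U = Gᵀ := by rw [hG, transpose_mul, transpose_transpose]
  have hAt : G * Yᵀ = Aᵀ := by rw [hA, transpose_mul, transpose_transpose]
  set M := A * H⁻¹ - U with hM
  set W := U'ᵀ * A * H⁻¹ with hW
  have hMH : A - U * H = M * H := by
    rw [hM, Matrix.sub_mul, Matrix.nonsing_inv_mul_cancel_right _ _ hdet]
  have hUM : Uᵀ * M = 0 := by
    rw [hM, Matrix.mul_sub, ← Matrix.mul_assoc, hUA, hU, Matrix.mul_nonsing_inv _ hdet, sub_self]
  have hUW : U' * W = U + M := by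
    rw [hW, ← Matrix.mul_assoc, mul_transpose_mul_eq_of_colSpace_le hU' hcol.ge, hM]
    abel
  have hWH : H * Wᵀ = Aᵀ * U' := by
    rw [hW, transpose_mul, transpose_mul, transpose_transpose, transpose_nonsing_inv, hHt,
      Matrix.mul_nonsing_inv_cancel_left _ _ hdet]
  have hgrad : frobSq (A - U * H) ≤ frobSq (M * G) * frobSq G := by
    rw [hMH, hH, ← Matrix.mul_assoc, ← frobSq_transpose G]
    exact frobSq_mul_le _ _
  have hWG : frobSq (W * G) = frobSq G + frobSq (M * G) := by
    rw [← frobSq_orthonormal_mul hU' (W * G), ← Matrix.mul_assoc, hUW, Matrix.add_mul,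
      frobSq_add_of_orthogonal, frobSq_orthonormal_mul hU]
    rw [transpose_mul, Matrix.mul_assoc, ← Matrix.mul_assoc Uᵀ, hUM, Matrix.zero_mul,
      Matrix.mul_zero]
  have hobj : frobSq (W * G) ≤ frobSq (Yᵀ * U') := by
    have horth : ((W * G)ᵀ)ᵀ * (Yᵀ * U' - (W * G)ᵀ) = 0 := by
      rw [transpose_transpose, transpose_mul, Matrix.mul_assoc, Matrix.mul_sub,
        ← Matrix.mul_assoc G, ← Matrix.mul_assoc G, hAt, ← hH, hWH, sub_self, Matrix.mul_zero]
    have hsum := frobSq_add_of_orthogonal horth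
    rw [add_sub_cancel, frobSq_transpose] at hsum
    linarith [frobSq_nonneg (Yᵀ * U' - (W * G)ᵀ)]
  rw [hGt, frobSq_transpose]
  have hG0 := frobSq_nonneg G
  have hMG0 := frobSq_nonneg (M * G)
  calc frobSq (A - U * H) ≤ frobSq G * frobSq (M * G) := by rwa [mul_comm]
    _ ≤ frobSq (Yᵀ * U') * (frobSq (Yᵀ * U') - frobSq G) := by gcongr <;> linarith
end
end

section
/- With U ∈ ℝ^{I×K} having orthonormal columns, Y ∈ ℝ^{I×J}, G := UᵀY, and A := Y Gᵀ = Y Yᵀ U, the compression of the Gram matrix of A by U satisfies Uᵀ A Aᵀ U = (G Gᵀ)², i.e. its eigenvalues are exactly the squares of the eigenvalues of G Gᵀ; combined with the Cauchy interlacing (Poincaré separation) of the eigenvalues of A Aᵀ, this yields σ_k(A)² ≥ λ_k(G Gᵀ)² for k = 1,…,K, where σ_k(A) are the singular values of A and λ_k(G Gᵀ) the eigenvalues of G Gᵀ, both in descending order. -/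
open Matrix

noncomputable section

/-- The quadratic form of an operator diagonalized by an orthonormal basis. -/
theorem OrthonormalBasis.inner_apply_eq_sum_of_eigenvectors {ι E : Type*} [Fintype ι]
    [NormedAddCommGroup E] [InnerProductSpace ℝ E] (b : OrthonormalBasis ι ℝ E)
    (T : E →ₗ[ℝ] E) (a : ι → ℝ) (hT : ∀ i, T (b i) = a i • b i) (x : E) :
    inner ℝ x (T x) = ∑ i, a i * inner ℝ (b i) x ^ 2 := by
  have hTx : T x = ∑ i, inner ℝ (b i) x • a i • b i := by
    conv_lhs => rw [← b.sum_repr' x]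
    simp [map_sum, hT]
  rw [hTx, inner_sum]
  refine Finset.sum_congr rfl fun i _ => ?_
  rw [inner_smul_right, inner_smul_right, real_inner_comm]
  ring

/-- The span of the first `k + 1` vectors of one basis meets the span of the vectors of index at
least `k` of another one. -/
theorem OrthonormalBasis.exists_ne_zero_inner_eq_zero {n : ℕ} {E : Type*}
    [NormedAddCommGroup E] [InnerProductSpace ℝ E] (b c : OrthonormalBasis (Fin n) ℝ E)
    (k : Fin n) :
    ∃ x : E, x ≠ 0 ∧ (∀ i, k < i → inner ℝ (b i) x = 0) ∧ ∀ i, i < k → inner ℝ (c i) x = 0 := by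
  have : FiniteDimensional ℝ E := b.toBasis.finiteDimensional_of_finite
  let f : E →ₗ[ℝ] ({i : Fin n // i ≠ k} → ℝ) :=
    LinearMap.pi fun i => innerₛₗ ℝ (if i.1 < k then c i else b i)
  have hk : f.ker ≠ ⊥ := by
    apply LinearMap.ker_ne_bot_of_finrank_lt
    have := k.pos
    rw [Module.finrank_eq_card_basis b.toBasis, Module.finrank_fintype_fun_eq_card]
    simp
    omega
  obtain ⟨x, hx, hx0⟩ := Submodule.exists_mem_ne_zero_of_ne_bot hk
  have hf (i : Fin n) (hi : i ≠ k) : inner ℝ (if i < k then c i else b i) x = 0 :=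
    congrFun (LinearMap.mem_ker.mp hx) ⟨i, hi⟩
  refine ⟨x, hx0, fun i hi => ?_, fun i hi => ?_⟩
  · simpa [hi.not_gt] using hf i hi.ne'
  · simpa [hi] using hf i hi.ne

/-- **Weyl monotonicity**: the ordered eigenvalues are monotone in the quadratic form. -/
theorem OrthonormalBasis.eigenvalue_le_of_inner_le {n : ℕ} {E : Type*}
    [NormedAddCommGroup E] [InnerProductSpace ℝ E] (b c : OrthonormalBasis (Fin n) ℝ E)
    (T S : E →ₗ[ℝ] E) {α β : Fin n → ℝ} (hα : Antitone α) (hβ : Antitone β)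
    (hT : ∀ i, T (b i) = α i • b i) (hS : ∀ i, S (c i) = β i • c i)
    (hTS : ∀ x, inner ℝ x (T x) ≤ inner ℝ x (S x)) (k : Fin n) : α k ≤ β k := by
  obtain ⟨x, hx0, hb, hc⟩ := b.exists_ne_zero_inner_eq_zero c k
  have hlower : α k * ‖x‖ ^ 2 ≤ inner ℝ x (T x) := by
    rw [b.inner_apply_eq_sum_of_eigenvectors T α hT, ← b.sum_sq_inner_right, Finset.mul_sum]
    refine Finset.sum_le_sum fun i _ => ?_
    rcases le_or_gt i k with hi | hi
    · exact mul_le_mul_of_nonneg_right (hα hi) (sq_nonneg _)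
    · simp [hb i hi]
  have hupper : inner ℝ x (S x) ≤ β k * ‖x‖ ^ 2 := by
    rw [c.inner_apply_eq_sum_of_eigenvectors S β hS, ← c.sum_sq_inner_right, Finset.mul_sum]
    refine Finset.sum_le_sum fun i _ => ?_
    rcases le_or_gt k i with hi | hi
    · exact mul_le_mul_of_nonneg_right (hβ hi) (sq_nonneg _)
    · simp [hc i hi]
  have hx : 0 < ‖x‖ ^ 2 := by positivity
  exact le_of_mul_le_mul_right (hlower.trans ((hTS x).trans hupper)) hx

/-- The transpose of a matrix with orthonormal columns is a contraction. -/
theorem Matrix.dotProduct_transpose_mulVec_self_le_s17 {m n : Type*} [Fintype m] [Fintype n]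
    [DecidableEq n] {U : Matrix m n ℝ} (hU : Uᵀ * U = 1) (y : m → ℝ) :
    (Uᵀ *ᵥ y) ⬝ᵥ (Uᵀ *ᵥ y) ≤ y ⬝ᵥ y := by
  have hcross : (U *ᵥ (Uᵀ *ᵥ y)) ⬝ᵥ y = (Uᵀ *ᵥ y) ⬝ᵥ (Uᵀ *ᵥ y) := by
    rw [dotProduct_comm, dotProduct_mulVec, ← mulVec_transpose]
  have hproj : (U *ᵥ (Uᵀ *ᵥ y)) ⬝ᵥ (U *ᵥ (Uᵀ *ᵥ y)) = (Uᵀ *ᵥ y) ⬝ᵥ (Uᵀ *ᵥ y) := by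
    rw [dotProduct_mulVec, ← mulVec_transpose, mulVec_mulVec, hU, one_mulVec]
  have hnonneg : 0 ≤ (y - U *ᵥ (Uᵀ *ᵥ y)) ⬝ᵥ (y - U *ᵥ (Uᵀ *ᵥ y)) :=
    Finset.sum_nonneg fun i _ => mul_self_nonneg _
  rw [sub_dotProduct, dotProduct_sub, dotProduct_sub, dotProduct_comm y (U *ᵥ _), hcross, hproj] at hnonneg
  linarith

/-- With `U` having orthonormal columns, `G := Uᵀ Y`, `A := Y Gᵀ = Y Yᵀ U`, the
compression of the Gram matrix of `A` by `U` satisfies `Uᵀ A Aᵀ U = (G Gᵀ)²`;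
combined with the Cauchy interlacing (Poincaré separation) of the eigenvalues of
`A Aᵀ`, this yields `σ_k(A)² ≥ λ_k(G Gᵀ)²` for `k = 1,…,K`, where `σ_k(A)` are the
singular values of `A` (square roots of the eigenvalues of `Aᵀ A`) and `λ_k(G Gᵀ)`
the eigenvalues of `G Gᵀ`, both listed in descending order. -/
theorem compression_and_interlacing {I J K : ℕ}
    (Y : Matrix (Fin I) (Fin J) ℝ) (U : Matrix (Fin I) (Fin K) ℝ)
    (hU : Uᵀ * U = 1)
    (G : Matrix (Fin K) (Fin J) ℝ) (hG : G = Uᵀ * Y)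
    (A : Matrix (Fin I) (Fin K) ℝ) (hA : A = Y * Gᵀ)
    (hAH : (Aᵀ * A).IsHermitian) (hGH : (G * Gᵀ).IsHermitian)
    (σ lam : Fin K → ℝ) (hσmono : Antitone σ) (hlmono : Antitone lam)
    (eσ : Fin K ≃ Fin K) (hσ : ∀ k, σ k = Real.sqrt (hAH.eigenvalues (eσ k)))
    (el : Fin K ≃ Fin K) (hl : ∀ k, lam k = hGH.eigenvalues (el k)) :
    Uᵀ * (A * Aᵀ) * U = (G * Gᵀ) * (G * Gᵀ) ∧ ∀ k, (lam k) ^ 2 ≤ (σ k) ^ 2 := by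
  have hUA : Uᵀ * A = G * Gᵀ := by rw [hA, hG, Matrix.mul_assoc]
  have hsymm : (G * Gᵀ)ᵀ = G * Gᵀ := by simp
  have hAU : Aᵀ * U = G * Gᵀ := by rw [← hsymm, ← hUA]; simp
  refine ⟨by rw [← Matrix.mul_assoc, hUA, Matrix.mul_assoc, hAU], fun k => ?_⟩
  have hGpos : (G * Gᵀ).PosSemidef := by
    simpa using Matrix.posSemidef_self_mul_conjTranspose G
  have hApos : (Aᵀ * A).PosSemidef := by
    simpa using Matrix.posSemidef_conjTranspose_mul_self A
  have hlam (i) : 0 ≤ lam i := hl i ▸ hGpos.eigenvalues_nonneg _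
  have hσ0 (i) : 0 ≤ σ i := hσ i ▸ Real.sqrt_nonneg _
  have hσsq (i) : σ i ^ 2 = hAH.eigenvalues (eσ i) := by
    rw [hσ, Real.sq_sqrt (hApos.eigenvalues_nonneg _)]
  refine (hGH.eigenvectorBasis.reindex el.symm).eigenvalue_le_of_inner_le
    (hAH.eigenvectorBasis.reindex eσ.symm)
    (toEuclideanLin ((G * Gᵀ) * (G * Gᵀ))) (toEuclideanLin (Aᵀ * A))
    (α := fun k => lam k ^ 2) (β := fun k => σ k ^ 2)
    (fun i j hij => pow_le_pow_left₀ (hlam j) (hlmono hij) 2)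
    (fun i j hij => pow_le_pow_left₀ (hσ0 j) (hσmono hij) 2) ?_ ?_ ?_ k
  · intro i
    apply WithLp.ofLp_injective
    have hM := hGH.mulVec_eigenvectorBasis (el i)
    have hMM : ((G * Gᵀ) * (G * Gᵀ)) *ᵥ (hGH.eigenvectorBasis (el i)).ofLp =
        hGH.eigenvalues (el i) ^ 2 • (hGH.eigenvectorBasis (el i)).ofLp := by
      rw [← mulVec_mulVec, hM, mulVec_smul, hM, smul_smul, sq]
    simpa [toLpLin_apply, hl, Matrix.mul_assoc] using hMM
  · intro i
    apply WithLp.ofLp_injective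
    simp [toLpLin_apply, hAH.mulVec_eigenvectorBasis, hσsq]
  · intro x
    have hquad {m : ℕ} (B : Matrix (Fin m) (Fin K) ℝ) :
        inner ℝ x (toEuclideanLin (Bᵀ * B) x) = (B *ᵥ x.ofLp) ⬝ᵥ (B *ᵥ x.ofLp) := by
      rw [EuclideanSpace.inner_eq_star_dotProduct, toLpLin_apply, ← mulVec_mulVec,
        mulVec_transpose, star_trivial, ← dotProduct_mulVec]
    have hle := dotProduct_transpose_mulVec_self_le_s17 hU (A *ᵥ x.ofLp)
    rw [mulVec_mulVec, hUA, ← hquad, ← hquad, hsymm] at hle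
    exact hle
end
end
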